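/- Let A := sgn Q(0) + sgn Q(2π/3) + sgn Q(4π/3) as a bounded operator on L²(ℝ). Then the number 3 is not an eigenvalue of A; that is, there is no nonzero ψ ∈ L²(ℝ) with Aψ = 3ψ. -/

import Mathlib

open MeasureTheory Complex Real
open scoped InnerProductSpace ComplexConjugate

noncomputable section

/-- The complex Hilbert space `L²(ℝ, ℂ)`. -/
abbrev L2 : Type := Lp ℂ 2 (volume : Measure ℝ)

/-- `F` is the Fourier–Plancherel unitary operator on `L²(ℝ)`,
with convention `(Fψ)(p) = (2π)^{-1/2} ∫ e^{-ipq} ψ(q) dq`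
(this property on the dense subspace `L¹ ∩ L²` determines `F` uniquely). -/
def IsFourier (F : L2 ≃ₗᵢ[ℂ] L2) : Prop :=
  ∀ ψ : L2, Integrable (⇑ψ) volume →
    (F ψ : ℝ → ℂ) =ᵐ[volume]
      fun p : ℝ => (((2 * π) ^ (-(1:ℝ)/2) : ℝ) : ℂ) *
        ∫ q : ℝ, Complex.exp (-(Complex.I) * (p : ℂ) * (q : ℂ)) * ψ q

/-- `T` is the bounded multiplication operator `M_g` by `g` on `L²(ℝ)`. -/
def IsMulOp (g : ℝ → ℂ) (T : L2 →L[ℂ] L2) : Prop :=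
  ∀ ψ : L2, (T ψ : ℝ → ℂ) =ᵐ[volume] fun q => g q * ψ q

/-- `T = sgn P := 𝓕⁻¹ ∘ M_sgn ∘ 𝓕`. -/
def IsSgnP (T : L2 →L[ℂ] L2) : Prop :=
  ∃ F : L2 ≃ₗᵢ[ℂ] L2, IsFourier F ∧
    ∀ ψ : L2, (F (T ψ) : ℝ → ℂ) =ᵐ[volume]
      fun p => ((Real.sign p : ℝ) : ℂ) * (F ψ : ℝ → ℂ) p

/-- `χ_t(q) = exp(−(i/2)(cot t) q²)`. -/
def chi (t q : ℝ) : ℂ :=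
  Complex.exp (-(Complex.I / 2) * ((Real.cos t / Real.sin t : ℝ) : ℂ) * (q : ℂ) ^ 2)

/-- `T = sgn Q(t)`: for `t = 0` this is `M_sgn`, and for `sin t ≠ 0` it is
`sgn(sin t) · M_{χ_t} ∘ (sgn P) ∘ M_{χ_t}⁻¹`, which realizes `sgn(Q cos t + P sin t)`. -/
def IsSgnQ (t : ℝ) (T : L2 →L[ℂ] L2) : Prop :=
  if t = 0 then IsMulOp (fun q => ((Real.sign q : ℝ) : ℂ)) T
  else ∃ P Mc Mci : L2 →L[ℂ] L2, IsSgnP P ∧ IsMulOp (chi t) Mc ∧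
    IsMulOp (fun q => (chi t q)⁻¹) Mci ∧
    T = (((Real.sign (Real.sin t) : ℝ) : ℂ) • (Mc ∘L P ∘L Mci))

theorem norm_cexp_neg_mul_mul_le {w c : ℂ} {q : ℝ} (hw : 0 ≤ w.re) (hq : 0 < q) :
    ‖cexp (-w * q) * c‖ ≤ ‖c‖ := by
  rw [norm_mul, Complex.norm_exp]
  have : (-w * (q : ℂ)).re ≤ 0 := by
    simp only [neg_mul, neg_re, mul_re, ofReal_re, ofReal_im, mul_zero, sub_zero]
    nlinarith [mul_nonneg hw hq.le]
  exact mul_le_of_le_one_left (norm_nonneg _) (Real.exp_le_one_iff.2 this)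

theorem continuousOn_laplace {g : ℝ → ℂ} (hg : IntegrableOn g (Set.Ioi 0)) :
    ContinuousOn (fun w : ℂ => ∫ q in Set.Ioi (0 : ℝ), cexp (-w * q) * g q) {w | 0 ≤ w.re} := by
  refine continuousOn_of_dominated (bound := fun q => ‖g q‖) (fun w _ => ?_) (fun w hw => ?_)
    hg.norm (Filter.Eventually.of_forall fun q => by fun_prop)
  · exact (by fun_prop : Continuous fun q : ℝ => cexp (-w * q)).aestronglyMeasurable.mul hg.1
  · filter_upwards [ae_restrict_mem measurableSet_Ioi] with q hq
    exact norm_cexp_neg_mul_mul_le hw hq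

theorem norm_laplace_le {g : ℝ → ℂ} (hg : IntegrableOn g (Set.Ioi 0)) {w : ℂ} (hw : 0 ≤ w.re) :
    ‖∫ q in Set.Ioi (0 : ℝ), cexp (-w * q) * g q‖ ≤ ∫ q in Set.Ioi (0 : ℝ), ‖g q‖ := by
  refine norm_integral_le_of_norm_le hg.norm ?_
  filter_upwards [ae_restrict_mem measurableSet_Ioi] with q hq
  exact norm_cexp_neg_mul_mul_le hw hq

theorem differentiableAt_laplace {g : ℝ → ℂ} (hg : IntegrableOn g (Set.Ioi 0)) {w : ℂ}
    (hw : 0 < w.re) :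
    DifferentiableAt ℂ (fun w : ℂ => ∫ q in Set.Ioi (0 : ℝ), cexp (-w * q) * g q) w := by
  have hs : {z : ℂ | w.re / 2 < z.re} ∈ nhds w :=
    (isOpen_lt continuous_const Complex.continuous_re).mem_nhds (by simp; linarith)
  refine (hasDerivAt_integral_of_dominated_loc_of_deriv_le (𝕜 := ℂ)
    (F := fun (w : ℂ) (q : ℝ) => cexp (-w * q) * g q)
    (F' := fun (w : ℂ) (q : ℝ) => cexp (-w * q) * (-q) * g q)
    (bound := fun q => (2 / w.re) * ‖g q‖) hs ?_ ?_ ?_ ?_ (hg.norm.const_mul _) ?_).2.differentiableAt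
  · refine Filter.Eventually.of_forall fun z => ?_
    exact (by fun_prop : Continuous fun q : ℝ => cexp (-z * q)).aestronglyMeasurable.mul hg.1
  · refine hg.norm.mono' ?_ ?_
    · exact (by fun_prop : Continuous fun q : ℝ => cexp (-w * q)).aestronglyMeasurable.mul hg.1
    · filter_upwards [ae_restrict_mem measurableSet_Ioi] with q hq
      exact norm_cexp_neg_mul_mul_le hw.le hq
  · exact (by fun_prop : Continuous fun q : ℝ => cexp (-w * q) * (-q)).aestronglyMeasurable.mul hg.1
  · filter_upwards [ae_restrict_mem measurableSet_Ioi] with q hq z hz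
    have hq : 0 < q := hq
    have hz : w.re / 2 < z.re := hz
    rw [norm_mul, norm_mul, Complex.norm_exp, norm_neg, Complex.norm_real, Real.norm_of_nonneg hq.le]
    gcongr
    have h1 : (-z * (q : ℂ)).re = -(z.re * q) := by simp
    rw [h1, Real.exp_neg, inv_mul_le_iff₀ (Real.exp_pos _)]
    have h2 : z.re * q ≤ Real.exp (z.re * q) := by linarith [Real.add_one_le_exp (z.re * q)]
    calc q = (w.re / 2 * q) * (2 / w.re) := by field_simp
      _ ≤ (z.re * q) * (2 / w.re) := by gcongr
      _ ≤ _ := by gcongr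
  · refine Filter.Eventually.of_forall fun q z _ => ?_
    have h : HasDerivAt (fun z : ℂ => -z * (q : ℂ)) (-q) z := by
      simpa using (hasDerivAt_id z).neg.mul_const (q : ℂ)
    exact h.cexp.mul_const _

/-- If the Laplace transform of a function integrable on the half-line vanishes on the negative
half of the imaginary axis, then it vanishes on the closed right half-plane. -/
theorem laplace_eq_zero {g : ℝ → ℂ} (hg : IntegrableOn g (Set.Ioi 0))
    (h : ∀ s : ℝ, s < 0 → ∫ q in Set.Ioi (0 : ℝ), cexp (-(s * I) * q) * g q = 0)
    {w : ℂ} (hw : 0 ≤ w.re) : ∫ q in Set.Ioi (0 : ℝ), cexp (-w * q) * g q = 0 := by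
  set L : ℂ → ℂ := fun w => ∫ q in Set.Ioi (0 : ℝ), cexp (-w * q) * g q
  set C : ℝ := ∫ q in Set.Ioi (0 : ℝ), ‖g q‖
  have re_exp (z : ℂ) : (cexp (I * z)).re = Real.exp (-z.im) * Real.cos z.re := by
    simp [Complex.exp_re]
  have hpi := Real.pi_pos
  have hcl : closure (HadamardThreeLines.verticalStrip (-(π / 2)) (π / 2)) ⊆
      HadamardThreeLines.verticalClosedStrip (-(π / 2)) (π / 2) :=
    closure_minimal (Set.preimage_mono Set.Ioo_subset_Icc_self)
      (isClosed_Icc.preimage Complex.continuous_re)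
  have hre (z : ℂ) (hz : z ∈ HadamardThreeLines.verticalClosedStrip (-(π / 2)) (π / 2)) :
      0 ≤ (cexp (I * z)).re := by
    rw [re_exp]
    exact mul_nonneg (Real.exp_pos _).le (Real.cos_nonneg_of_mem_Icc hz)
  have hd : DiffContOnCl ℂ (fun z => L (cexp (I * z)))
      (HadamardThreeLines.verticalStrip (-(π / 2)) (π / 2)) := by
    constructor
    · intro z hz
      refine (DifferentiableAt.comp z (differentiableAt_laplace hg ?_)
        (by fun_prop)).differentiableWithinAt
      rw [re_exp]
      exact mul_pos (Real.exp_pos _) (Real.cos_pos_of_mem_Ioo hz)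
    · exact (continuousOn_laplace hg).comp (by fun_prop) fun z hz => hre z (hcl hz)
  have hB : BddAbove ((norm ∘ fun z => L (cexp (I * z))) ''
      HadamardThreeLines.verticalClosedStrip (-(π / 2)) (π / 2)) := by
    refine ⟨C, ?_⟩
    rintro _ ⟨z, hz, rfl⟩
    exact norm_laplace_le hg (hre z hz)
  have hpos : ∀ w : ℂ, 0 < w.re → L w = 0 := by
    intro w hw
    have hw0 : w ≠ 0 := by rintro rfl; simp at hw
    set z : ℂ := -I * Complex.log w with hz
    have hwz : cexp (I * z) = w := by
      rw [hz, ← mul_assoc]; simp [Complex.exp_log hw0]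
    have hzre : z.re = w.arg := by simp [hz, Complex.log_im]
    have harg := abs_lt.1 (Complex.abs_arg_lt_pi_div_two_iff.2 (Or.inl hw))
    have key := HadamardThreeLines.norm_le_interp_of_mem_verticalClosedStrip' (a := 0) (b := C)
      (z := z) (by linarith) ⟨by rw [hzre]; linarith, by rw [hzre]; linarith⟩ hd hB ?_ ?_
    · rw [hwz, Real.zero_rpow, zero_mul] at key
      · exact norm_le_zero_iff.1 key
      · rw [hzre, sub_ne_zero, ne_comm]
        refine (div_lt_one (by linarith)).2 (by linarith) |>.ne
    · intro z hz
      have hz : z.re = -(π / 2) := hz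
      have : cexp (I * z) = ((-Real.exp (-z.im) : ℝ) : ℂ) * I := by
        apply Complex.ext <;> simp [Complex.exp_re, Complex.exp_im, hz, -Complex.ofReal_exp]
      rw [this]
      exact norm_le_zero_iff.2 (h _ (neg_lt_zero.2 (Real.exp_pos _)))
    · intro z hz
      have hz : z.re = π / 2 := hz
      exact norm_laplace_le hg (hre z ⟨by rw [hz]; linarith, by rw [hz]⟩)
  refine Set.EqOn.of_subset_closure (f := L) (g := fun _ => 0) (s := {w : ℂ | 0 < w.re})
    (t := {w : ℂ | 0 ≤ w.re}) (fun w hw => hpos w hw) (continuousOn_laplace hg)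
    continuousOn_const (fun w hw => le_of_lt (show 0 < w.re from hw)) ?_ hw
  rw [Complex.closure_setOfPred_lt_re]

/-- If an integrable function vanishes on the negative half-line together with its Fourier
transform, then its Fourier transform vanishes identically. -/
theorem integral_cexp_mul_eq_zero {g : ℝ → ℂ} (hg : Integrable g)
    (hneg : ∀ᵐ q : ℝ, q < 0 → g q = 0)
    (h : ∀ s : ℝ, s < 0 → ∫ q : ℝ, cexp (-I * s * q) * g q = 0) (s : ℝ) :
    ∫ q : ℝ, cexp (-I * s * q) * g q = 0 := by
  have key (s : ℝ) : ∫ q in Set.Ioi (0 : ℝ), cexp (-(s * I) * q) * g q =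
      ∫ q : ℝ, cexp (-I * s * q) * g q := by
    have e (q : ℝ) : cexp (-(s * I) * q) = cexp (-I * s * q) := by ring_nf
    simp_rw [e]
    refine setIntegral_eq_integral_of_ae_compl_eq_zero ?_
    filter_upwards [hneg, Measure.ae_ne volume (0 : ℝ)] with q hq hq0 hq'
    rw [hq (lt_of_le_of_ne (not_lt.1 hq') hq0), mul_zero]
  rw [← key]
  exact laplace_eq_zero hg.integrableOn (fun s hs => (key s).trans (h s hs)) (by simp)

theorem one_add_mul_I_ne_zero (q : ℝ) : (1 + q * I : ℂ) ≠ 0 := by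
  intro h
  simpa using congrArg Complex.re h

theorem norm_inv_one_add_mul_I_sq (q : ℝ) : ‖((1 + q * I : ℂ) ^ 2)⁻¹‖ = (1 + q ^ 2)⁻¹ := by
  rw [norm_inv, norm_pow, Complex.sq_norm, Complex.normSq_apply]
  simp
  ring

theorem continuous_inv_one_add_mul_I_sq : Continuous fun q : ℝ => ((1 + q * I : ℂ) ^ 2)⁻¹ :=
  (by fun_prop : Continuous fun q : ℝ => (1 + q * I : ℂ) ^ 2).inv₀
    fun q => pow_ne_zero 2 (one_add_mul_I_ne_zero q)

theorem integrable_inv_one_add_mul_I_sq : Integrable fun q : ℝ => ((1 + q * I : ℂ) ^ 2)⁻¹ :=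
  integrable_inv_one_add_sq.mono' continuous_inv_one_add_mul_I_sq.aestronglyMeasurable
    (Filter.Eventually.of_forall fun q => (norm_inv_one_add_mul_I_sq q).le)

theorem integrableOn_id_mul_exp_neg :
    IntegrableOn (fun x : ℝ => x * Real.exp (-x)) (Set.Ioi 0) := by
  refine (Real.GammaIntegral_convergent two_pos).congr_fun (fun x _ => ?_) measurableSet_Ioi
  norm_num
  ring

theorem integrable_max_mul_exp_neg :
    Integrable fun x : ℝ => ((max x 0 * Real.exp (-x) : ℝ) : ℂ) := by
  have h : Integrable fun x : ℝ => max x 0 * Real.exp (-x) := by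
    refine (integrableOn_iff_integrable_of_support_subset (s := Set.Ioi 0) fun x hx => ?_).1
      (integrableOn_id_mul_exp_neg.congr_fun (fun x hx => ?_) measurableSet_Ioi)
    · by_contra h
      exact hx (by simp [max_eq_right (Set.notMem_Ioi.1 h)])
    · simp only [max_eq_left (le_of_lt (show (0 : ℝ) < x from hx))]
  exact h.ofReal

theorem integral_mul_cexp_neg (r : ℝ) :
    ∫ x in Set.Ioi (0 : ℝ), (x : ℂ) * cexp (-(1 + r * I) * x) = ((1 + r * I : ℂ) ^ 2)⁻¹ := by
  set a : ℂ := 1 + r * I with ha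
  have ha0 : a ≠ 0 := one_add_mul_I_ne_zero r
  have hnorm (x : ℝ) : ‖cexp (-a * x)‖ = Real.exp (-x) := by
    rw [Complex.norm_exp]; simp [ha]
  have hd (x : ℝ) : HasDerivAt (fun x : ℝ => -((x : ℂ) / a + (a ^ 2)⁻¹) * cexp (-a * x))
      ((x : ℂ) * cexp (-a * x)) x := by
    have h1 : HasDerivAt (fun x : ℝ => (x : ℂ)) 1 x := Complex.ofRealCLM.hasDerivAt
    have h2 := (((h1.div_const a).add_const ((a ^ 2)⁻¹)).neg).mul ((h1.const_mul (-a)).cexp)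
    refine h2.congr_deriv ?_
    simp only [Pi.neg_apply]
    field_simp
    ring
  have hint : IntegrableOn (fun x : ℝ => (x : ℂ) * cexp (-a * x)) (Set.Ioi 0) := by
    refine integrableOn_id_mul_exp_neg.mono'
      (by fun_prop : Continuous fun x : ℝ => (x : ℂ) * cexp (-a * x)).aestronglyMeasurable ?_
    filter_upwards [ae_restrict_mem measurableSet_Ioi] with x hx
    rw [norm_mul, hnorm, Complex.norm_real, Real.norm_of_nonneg (le_of_lt hx)]
  have hlim : Filter.Tendsto (fun x : ℝ => -((x : ℂ) / a + (a ^ 2)⁻¹) * cexp (-a * x))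
      Filter.atTop (nhds 0) := by
    have l0 := Real.tendsto_pow_mul_exp_neg_atTop_nhds_zero 0
    have l1 := Real.tendsto_pow_mul_exp_neg_atTop_nhds_zero 1
    have l := (l1.const_mul ‖a‖⁻¹).add (l0.const_mul ‖(a ^ 2)⁻¹‖)
    simp only [mul_zero, add_zero] at l
    refine squeeze_zero_norm' ?_ l
    filter_upwards [Filter.eventually_ge_atTop 0] with x hx
    rw [norm_mul, hnorm, norm_neg]
    calc ‖(x : ℂ) / a + (a ^ 2)⁻¹‖ * Real.exp (-x)
        ≤ (‖(x : ℂ) / a‖ + ‖(a ^ 2)⁻¹‖) * Real.exp (-x) := by gcongr; exact norm_add_le _ _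
      _ = _ := by
        rw [norm_div, Complex.norm_real, Real.norm_of_nonneg hx]
        ring
  rw [integral_Ioi_of_hasDerivAt_of_tendsto' (fun x _ => hd x) hint hlim]
  simp

theorem fourier_max_mul_exp_neg (r : ℝ) :
    FourierTransform.fourier (fun x : ℝ => ((max x 0 * Real.exp (-x) : ℝ) : ℂ)) r =
      ((1 + (2 * π * r : ℝ) * I : ℂ) ^ 2)⁻¹ := by
  rw [Real.fourier_real_eq_integral_exp_smul, ← integral_mul_cexp_neg,
    ← setIntegral_eq_integral_of_ae_compl_eq_zero (s := Set.Ioi 0)]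
  · refine setIntegral_congr_fun measurableSet_Ioi fun x hx => ?_
    simp only [max_eq_left (le_of_lt (show (0 : ℝ) < x from hx)), smul_eq_mul]
    push_cast
    rw [mul_left_comm, ← Complex.exp_add]
    ring_nf
  · refine Filter.Eventually.of_forall fun x hx => ?_
    simp [max_eq_right (Set.notMem_Ioi.1 hx)]

/-- The function `(1 + iq)⁻²` has one-sided Fourier spectrum. -/
theorem integral_cexp_mul_inv_one_add_mul_I_sq {x : ℝ} (hx : x ≤ 0) :
    ∫ q : ℝ, cexp (I * x * q) * ((1 + q * I : ℂ) ^ 2)⁻¹ = 0 := by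
  set k : ℝ → ℂ := fun x => ((max x 0 * Real.exp (-x) : ℝ) : ℂ) with hk
  have hF : FourierTransform.fourier k =
      fun r : ℝ => ((1 + (2 * π * r : ℝ) * I : ℂ) ^ 2)⁻¹ := funext fourier_max_mul_exp_neg
  have h2 : (2 * π : ℝ) ≠ 0 := by positivity
  have hint : Integrable (FourierTransform.fourier k) := by
    rw [hF]
    exact integrable_inv_one_add_mul_I_sq.comp_mul_left' h2
  have hinv := congrFun (Continuous.fourierInv_fourier_eq (f := k) (by fun_prop)
    integrable_max_mul_exp_neg hint) x
  rw [hF, Real.fourierInv_eq'] at hinv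
  have hcv := Measure.integral_comp_mul_left
    (fun q : ℝ => cexp (I * x * q) * ((1 + q * I : ℂ) ^ 2)⁻¹) (2 * π)
  have hz : ∫ r : ℝ, cexp (I * x * (2 * π * r : ℝ)) * ((1 + (2 * π * r : ℝ) * I : ℂ) ^ 2)⁻¹ = 0 := by
    have hk0 : k x = 0 := by simp [hk, max_eq_right hx]
    rw [← hk0, ← hinv]
    refine integral_congr_ae (Filter.Eventually.of_forall fun r => ?_)
    simp only [smul_eq_mul, RCLike.inner_apply, conj_trivial]
    congr 2
    push_cast
    ring
  rw [hz] at hcv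
  exact (smul_eq_zero.1 hcv.symm).resolve_left (by positivity)

/-- A square-integrable function supported on the positive half-line whose Fourier transform is
also supported on the positive half-line is zero. -/
theorem eq_zero_of_fourier_eq_zero_of_neg {F : L2 ≃ₗᵢ[ℂ] L2} (hF : IsFourier F) (f : L2)
    (hf : ∀ᵐ q : ℝ, q < 0 → f q = 0) (hFf : ∀ᵐ p : ℝ, p < 0 → F f p = 0) : f = 0 := by
  set m : ℝ → ℂ := fun q => ((1 + q * I : ℂ) ^ 2)⁻¹ with hm
  have hmc : Continuous m := continuous_inv_one_add_mul_I_sq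
  have hm1 (q : ℝ) : ‖m q‖ ≤ 1 := by
    rw [hm, norm_inv_one_add_mul_I_sq]
    exact inv_le_one_of_one_le₀ (by nlinarith)
  have hm0 (q : ℝ) : m q ≠ 0 := inv_ne_zero (pow_ne_zero 2 (one_add_mul_I_ne_zero q))
  have hmi : Integrable m := integrable_inv_one_add_mul_I_sq
  have hm2 : MemLp m 2 := by
    refine (memLp_two_iff_integrable_sq_norm hmc.aestronglyMeasurable).2 ?_
    refine hmi.norm.mono' (by fun_prop) (Filter.Eventually.of_forall fun q => ?_)
    rw [Real.norm_of_nonneg (by positivity)]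
    nlinarith [hm1 q, norm_nonneg (m q)]
  have hexp (s q : ℝ) : ‖cexp (I * s * q)‖ = 1 := by
    rw [Complex.norm_exp]; simp
  set g : ℝ → ℂ := fun q => conj (m q) * f q with hg
  have hgm : AEStronglyMeasurable g :=
    (Complex.continuous_conj.comp hmc).aestronglyMeasurable.mul (Lp.aestronglyMeasurable f)
  have hgi : Integrable g := by
    refine (hm2.integrable_mul (Lp.memLp f)).mono hgm (Filter.Eventually.of_forall fun q => ?_)
    simp [hg]
  have hg2 : MemLp g 2 := by
    refine (Lp.memLp f).of_le hgm (Filter.Eventually.of_forall fun q => ?_)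
    rw [hg, norm_mul, RCLike.norm_conj]
    exact mul_le_of_le_one_left (norm_nonneg _) (hm1 q)
  have hzero : ∀ s : ℝ, s < 0 → ∫ q : ℝ, cexp (-I * s * q) * g q = 0 := by
    intro s hs
    have hvm : AEStronglyMeasurable (fun q : ℝ => cexp (I * s * q) * m q) :=
      (by fun_prop : Continuous fun q : ℝ => cexp (I * s * q) * m q).aestronglyMeasurable
    have hv2 : MemLp (fun q : ℝ => cexp (I * s * q) * m q) 2 :=
      hm2.of_le hvm (Filter.Eventually.of_forall fun q => by rw [norm_mul, hexp, one_mul])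
    have hvi : Integrable (fun q : ℝ => cexp (I * s * q) * m q) :=
      hmi.mono hvm (Filter.Eventually.of_forall fun q => by rw [norm_mul, hexp, one_mul])
    have hV := hv2.coeFn_toLp
    have hFV := hF (hv2.toLp _) (hvi.congr hV.symm)
    have hin : ⟪F (hv2.toLp _), F f⟫_ℂ = 0 := by
      rw [L2.inner_def]
      refine integral_eq_zero_of_ae ?_
      filter_upwards [hFf, hFV] with p hp hp'
      rcases lt_or_ge p 0 with h | h
      · rw [hp h, inner_zero_right, Pi.zero_apply]
      · have : ∫ q : ℝ, cexp (-I * p * q) * (hv2.toLp _ : L2) q = 0 := by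
          rw [← integral_cexp_mul_inv_one_add_mul_I_sq (x := s - p) (by linarith)]
          refine integral_congr_ae ?_
          filter_upwards [hV] with q hq
          rw [hq, ← mul_assoc, ← Complex.exp_add]
          congr 2
          push_cast
          ring
        rw [hp', this, mul_zero, inner_zero_left, Pi.zero_apply]
    rw [F.inner_map_map, L2.inner_def] at hin
    rw [← hin]
    refine integral_congr_ae ?_
    filter_upwards [hV] with q hq
    rw [hq, RCLike.inner_apply, hg, map_mul, ← Complex.exp_conj]
    simp only [map_mul, Complex.conj_I, Complex.conj_ofReal]
    ring
  have hgneg : ∀ᵐ q : ℝ, q < 0 → g q = 0 := by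
    filter_upwards [hf] with q hq h
    simp only [hg, hq h, mul_zero]
  have hG := hg2.coeFn_toLp
  have hFG : F (hg2.toLp g) = 0 := by
    refine Lp.ext ?_
    filter_upwards [hF (hg2.toLp g) (hgi.congr hG.symm), Lp.coeFn_zero ℂ 2 (volume : Measure ℝ)]
      with p hp h0
    rw [hp, h0, Pi.zero_apply]
    have : ∫ q : ℝ, cexp (-I * p * q) * (hg2.toLp g : L2) q = 0 := by
      rw [← integral_cexp_mul_eq_zero hgi hgneg hzero p]
      refine integral_congr_ae ?_
      filter_upwards [hG] with q hq
      rw [hq]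
    rw [this, mul_zero]
  have hG0 : hg2.toLp g = 0 := by simpa using hFG
  rw [hG0] at hG
  refine Lp.ext ?_
  filter_upwards [hG, Lp.coeFn_zero ℂ 2 (volume : Measure ℝ)] with q hq h0
  rw [h0, Pi.zero_apply] at hq ⊢
  exact (mul_eq_zero.1 hq.symm).resolve_left ((map_ne_zero _).2 (hm0 q))

theorem norm_real_sign_le_one (x : ℝ) : ‖((Real.sign x : ℝ) : ℂ)‖ ≤ 1 := by
  rcases Real.sign_apply_eq x with h | h | h <;> simp [h]

theorem norm_chi (t q : ℝ) : ‖chi t q‖ = 1 := by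
  have : -(I / 2) * ((Real.cos t / Real.sin t : ℝ) : ℂ) * (q : ℂ) ^ 2 =
      ((-(Real.cos t / Real.sin t * q ^ 2 / 2) : ℝ) : ℂ) * I := by
    push_cast
    ring
  rw [chi, this, Complex.norm_exp_ofReal_mul_I]

theorem IsMulOp.norm_apply_le {g : ℝ → ℂ} {T : L2 →L[ℂ] L2} (hT : IsMulOp g T)
    (hg : ∀ q, ‖g q‖ ≤ 1) (ψ : L2) : ‖T ψ‖ ≤ ‖ψ‖ := by
  refine Lp.norm_le_norm_of_ae_le ?_
  filter_upwards [hT ψ] with q hq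
  rw [hq, norm_mul]
  exact mul_le_of_le_one_left (norm_nonneg _) (hg q)

theorem IsMulOp.apply_apply_of_mul_eq_one {g h : ℝ → ℂ} {S T : L2 →L[ℂ] L2} (hS : IsMulOp g S)
    (hT : IsMulOp h T) (hgh : ∀ q, g q * h q = 1) (ψ : L2) : S (T ψ) = ψ := by
  refine Lp.ext ?_
  filter_upwards [hS (T ψ), hT ψ] with q h1 h2
  rw [h1, h2, ← mul_assoc, hgh, one_mul]

theorem IsSgnP.norm_apply_le {T : L2 →L[ℂ] L2} (hT : IsSgnP T) (ψ : L2) : ‖T ψ‖ ≤ ‖ψ‖ := by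
  obtain ⟨F, -, h⟩ := hT
  rw [← F.norm_map (T ψ), ← F.norm_map ψ]
  refine Lp.norm_le_norm_of_ae_le ?_
  filter_upwards [h ψ] with p hp
  rw [hp, norm_mul]
  exact mul_le_of_le_one_left (norm_nonneg _) (norm_real_sign_le_one p)

theorem IsSgnQ.norm_apply_le {t : ℝ} {T : L2 →L[ℂ] L2} (hT : IsSgnQ t T) (ψ : L2) :
    ‖T ψ‖ ≤ ‖ψ‖ := by
  rw [IsSgnQ] at hT
  split_ifs at hT with ht
  · exact hT.norm_apply_le norm_real_sign_le_one ψ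
  · obtain ⟨P, Mc, Mci, hP, hMc, hMci, rfl⟩ := hT
    change ‖((Real.sign (Real.sin t) : ℝ) : ℂ) • Mc (P (Mci ψ))‖ ≤ ‖ψ‖
    rw [norm_smul]
    calc _ ≤ ‖Mc (P (Mci ψ))‖ :=
          mul_le_of_le_one_left (norm_nonneg _) (norm_real_sign_le_one _)
      _ ≤ ‖P (Mci ψ)‖ := hMc.norm_apply_le (fun q => (norm_chi t q).le) _
      _ ≤ ‖Mci ψ‖ := hP.norm_apply_le _
      _ ≤ ‖ψ‖ := hMci.norm_apply_le (fun q => by rw [norm_inv, norm_chi, inv_one]) _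

/-- If three vectors of norm at most `‖x‖` sum to `3 • x`, the first of them equals `x`. -/
theorem eq_of_add_add_eq_three_smul {E : Type*} [NormedAddCommGroup E] [InnerProductSpace ℂ E]
    {x a b c : E} (ha : ‖a‖ ≤ ‖x‖) (hb : ‖b‖ ≤ ‖x‖) (hc : ‖c‖ ≤ ‖x‖)
    (h : a + b + c = (3 : ℂ) • x) : a = x := by
  have bound {y : E} (hy : ‖y‖ ≤ ‖x‖) : RCLike.re ⟪y, x⟫_ℂ ≤ ‖x‖ ^ 2 := by
    have := re_inner_le_norm (𝕜 := ℂ) y x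
    nlinarith [norm_nonneg x]
  have hsum : RCLike.re ⟪a, x⟫_ℂ + RCLike.re ⟪b, x⟫_ℂ + RCLike.re ⟪c, x⟫_ℂ = 3 * ‖x‖ ^ 2 := by
    rw [← map_add, ← map_add, ← inner_add_left, ← inner_add_left, h, inner_smul_left,
      inner_self_eq_norm_sq_to_K, ← RCLike.ofReal_pow, RCLike.re_mul_ofReal]
    simp
  have hsub := norm_sub_sq (𝕜 := ℂ) a x
  have h0 : ‖a - x‖ ^ 2 ≤ 0 := by
    nlinarith [bound hb, bound hc, norm_nonneg a, norm_nonneg x]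
  rw [← sub_eq_zero, ← norm_eq_zero]
  exact pow_eq_zero_iff two_ne_zero |>.1 (le_antisymm h0 (by positivity))

theorem IsMulOp.ae_eq_zero_of_sign_fixed {T : L2 →L[ℂ] L2}
    (hT : IsMulOp (fun q => ((Real.sign q : ℝ) : ℂ)) T) {ψ : L2} (h : T ψ = ψ) :
    ∀ᵐ q : ℝ, q < 0 → ψ q = 0 := by
  filter_upwards [h ▸ hT ψ] with q hq hneg
  rw [Real.sign_of_neg hneg] at hq
  push_cast at hq
  linear_combination hq / 2

/-- With `A := sgn Q(0) + sgn Q(2π/3) + sgn Q(4π/3)`, the number `3` is not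
an eigenvalue of `A`: there is no nonzero `ψ ∈ L²(ℝ)` with `Aψ = 3ψ`. -/
theorem three_not_eigenvalue (A0 A2 A4 : L2 →L[ℂ] L2)
    (h0 : IsSgnQ 0 A0) (h2 : IsSgnQ (2 * π / 3) A2) (h4 : IsSgnQ (4 * π / 3) A4) :
    ¬ ∃ ψ : L2, ψ ≠ 0 ∧ (A0 + A2 + A4) ψ = (3 : ℂ) • ψ := by
  rintro ⟨ψ, hψ, hA⟩
  have hsum : A0 ψ + A2 ψ + A4 ψ = (3 : ℂ) • ψ := hA
  have b0 := h0.norm_apply_le ψ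
  have b2 := h2.norm_apply_le ψ
  have b4 := h4.norm_apply_le ψ
  have e0 : A0 ψ = ψ := eq_of_add_add_eq_three_smul b0 b2 b4 hsum
  have e2 : A2 ψ = ψ := eq_of_add_add_eq_three_smul b2 b0 b4 (by rw [← hsum]; abel)
  rw [IsSgnQ, if_pos rfl] at h0
  have hneg := h0.ae_eq_zero_of_sign_fixed e0
  have hpi := Real.pi_pos
  have hsin : 0 < Real.sin (2 * π / 3) := Real.sin_pos_of_pos_of_lt_pi (by positivity) (by linarith)
  rw [IsSgnQ, if_neg (by positivity)] at h2
  obtain ⟨P, Mc, Mci, ⟨F, hF, hP⟩, hMc, hMci, rfl⟩ := h2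
  have e2 : Mc (P (Mci ψ)) = ψ := by
    simpa [Real.sign_of_pos hsin] using e2
  have hchi (q : ℝ) : chi (2 * π / 3) q ≠ 0 := Complex.exp_ne_zero _
  have hfix : P (Mci ψ) = Mci ψ := by
    have := hMci.apply_apply_of_mul_eq_one hMc (fun q => inv_mul_cancel₀ (hchi q)) (P (Mci ψ))
    rwa [e2, eq_comm] at this
  have hf0 : Mci ψ = 0 := by
    refine eq_zero_of_fourier_eq_zero_of_neg hF (Mci ψ) ?_ ?_
    · filter_upwards [hneg, hMci ψ] with q hq hq' h
      rw [hq', hq h, mul_zero]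
    · filter_upwards [hfix ▸ hP (Mci ψ)] with p hp h
      rw [Real.sign_of_neg h] at hp
      push_cast at hp
      linear_combination hp / 2
  rw [hf0, map_zero, map_zero] at e2
  exact hψ e2.symm
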